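/- Let K = ℚ(cos(2π/7)) be the subfield of ℝ generated over ℚ by cos(2π/7). Then the image of f_anom = X⁴ − 5X³ − 29X² + 47X + 42 in K[X] under the inclusion ℚ → K remains irreducible. -/

import Mathlib

open Real Polynomial

/-- An irreducible polynomial stays irreducible over a finite extension of degree coprime to its
own degree. -/
theorem irreducible_map_of_coprime_finrank {F K : Type*} [Field F] [Field K] [Algebra F K]
    [FiniteDimensional F K] {f : F[X]} (hf : Irreducible f)
    (h : f.natDegree.Coprime (Module.finrank F K)) : Irreducible (f.map (algebraMap F K)) := by
  have hf0 : f.map (algebraMap F K) ≠ 0 := Polynomial.map_ne_zero hf.ne_zero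
  have hfu : ¬ IsUnit (f.map (algebraMap F K)) := by
    rw [Polynomial.isUnit_map]
    exact hf.not_isUnit
  obtain ⟨g, hg, hgf⟩ := WfDvdMonoid.exists_irreducible_factor hfu hf0
  have : Fact (Irreducible g) := ⟨hg⟩
  have hfin : FiniteDimensional K (AdjoinRoot g) := (AdjoinRoot.powerBasis hg.ne_zero).finite
  have hfinF : FiniteDimensional F (AdjoinRoot g) := FiniteDimensional.trans F K (AdjoinRoot g)
  have hgr : Module.finrank K (AdjoinRoot g) = g.natDegree := by
    rw [(AdjoinRoot.powerBasis hg.ne_zero).finrank, AdjoinRoot.powerBasis_dim]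
  have hroot : aeval (AdjoinRoot.root g) f = 0 := by
    rw [← aeval_map_algebraMap K, AdjoinRoot.aeval_eq, AdjoinRoot.mk_eq_zero]
    exact hgf
  have hdeg : (minpoly F (AdjoinRoot.root g)).natDegree = f.natDegree := by
    rw [← minpoly.eq_of_irreducible hf hroot]
    exact natDegree_mul_C (inv_ne_zero (leadingCoeff_ne_zero.2 hf.ne_zero))
  have hdvd : f.natDegree ∣ g.natDegree := by
    apply h.dvd_of_dvd_mul_left
    rw [← hgr, Module.finrank_mul_finrank, ← hdeg]
    exact minpoly.degree_dvd (Algebra.IsIntegral.isIntegral _)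
  have hle : (f.map (algebraMap F K)).natDegree ≤ g.natDegree := by
    rw [natDegree_map]
    exact Nat.le_of_dvd hg.natDegree_pos hdvd
  exact (associated_of_dvd_of_natDegree_le hgf hf0 hle).irreducible hg

/-- A monic integer polynomial that is irreducible modulo a prime is irreducible over `ℚ`. -/
theorem irreducible_map_rat_of_irreducible_map_zmod {f : ℤ[X]} (hf : f.Monic) (p : ℕ)
    [Fact p.Prime] (h : Irreducible (f.map (Int.castRingHom (ZMod p)))) :
    Irreducible (f.map (algebraMap ℤ ℚ)) :=
  hf.irreducible_iff_irreducible_map_fraction_map.1 (hf.irreducible_of_irreducible_map _ _ h)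

theorem irreducible_quartic_zmod_five :
    Irreducible (X ^ 4 + X ^ 2 + 2 * X + 2 : (ZMod 5)[X]) := by
  have no_root : ∀ x : ZMod 5, x ^ 4 + x ^ 2 + 2 * x + 2 ≠ 0 := by decide
  have no_quadratic : ∀ a b c d : ZMod 5, ¬ ∀ x : ZMod 5,
      (a + b * x + x ^ 2) * (c + d * x + x ^ 2) = x ^ 4 + x ^ 2 + 2 * x + 2 := by
    decide +kernel
  have : Fact (Nat.Prime 5) := ⟨by norm_num⟩
  have hd : (X ^ 4 + X ^ 2 + 2 * X + 2 : (ZMod 5)[X]).natDegree = 4 := by compute_degree!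
  have hm : (X ^ 4 + X ^ 2 + 2 * X + 2 : (ZMod 5)[X]).Monic := by monicity!
  rw [hm.irreducible_iff_natDegree']
  refine ⟨fun h => by simp [h] at hd, fun p q hp hq hpq hmem => ?_⟩
  have hsum : p.natDegree + q.natDegree = 4 := by rw [← hp.natDegree_mul hq, hpq, hd]
  rw [hd, Finset.mem_Ioc] at hmem
  obtain hq1 | hq2 : q.natDegree = 1 ∨ q.natDegree = 2 := by omega
  · obtain ⟨x, hx⟩ := exists_root_of_degree_eq_one ((degree_eq_iff_natDegree_eq hq.ne_zero).2 hq1)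
    have hev := congrArg (eval x) hpq
    rw [eval_mul, hx.eq_zero, mul_zero] at hev
    exact no_root x (by simpa using hev.symm)
  · have hp2 : p.natDegree = 2 := by omega
    have hp2' : p.coeff 2 = 1 := by rw [← hp2]; exact hp
    have hq2' : q.coeff 2 = 1 := by rw [← hq2]; exact hq
    rw [p.as_sum_range_C_mul_X_pow, q.as_sum_range_C_mul_X_pow, hp2, hq2] at hpq
    simp only [Finset.sum_range_succ, Finset.sum_range_zero, hp2', hq2'] at hpq
    exact no_quadratic (p.coeff 0) (p.coeff 1) (q.coeff 0) (q.coeff 1) fun x => by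
      simpa using congrArg (eval x) hpq

theorem irreducible_cubic_zmod_two : Irreducible (X ^ 3 + X ^ 2 + 1 : (ZMod 2)[X]) := by
  have no_root : ∀ x : ZMod 2, x ^ 3 + x ^ 2 + 1 ≠ 0 := by decide
  have : Fact (Nat.Prime 2) := ⟨by norm_num⟩
  have hd : (X ^ 3 + X ^ 2 + 1 : (ZMod 2)[X]).natDegree = 3 := by compute_degree!
  rw [irreducible_iff_roots_eq_zero_of_degree_le_three (by omega) (by omega),
    Multiset.eq_zero_iff_forall_notMem]
  intro x hx
  exact no_root x (by simpa using (mem_roots'.1 hx).2)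

/-- `2 cos (2π/7)` is a root of `X³ + X² - 2X - 1`. -/
theorem two_cos_two_pi_div_seven_cubic :
    (2 * cos (2 * π / 7)) ^ 3 + (2 * cos (2 * π / 7)) ^ 2 - 2 * (2 * cos (2 * π / 7)) - 1 = 0 := by
  have h1 : cos (2 * π / 7) ≠ 1 := by
    have := cos_lt_cos_of_nonneg_of_le_pi (x := 0) (y := 2 * π / 7) le_rfl
      (by linarith [pi_pos]) (by linarith [pi_pos])
    rw [cos_zero] at this
    exact this.ne
  have h4 : cos (2 * (2 * (2 * π / 7))) = cos (3 * (2 * π / 7)) := by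
    rw [← cos_two_pi_sub]
    congr 1
    ring
  rw [cos_two_mul, cos_two_mul, cos_three_mul] at h4
  apply mul_left_cancel₀ (sub_ne_zero.2 h1)
  linear_combination h4

theorem minpoly_two_cos_two_pi_div_seven :
    minpoly ℚ (2 * cos (2 * π / 7)) = X ^ 3 + X ^ 2 - 2 * X - 1 := by
  have : Fact (Nat.Prime 2) := ⟨by norm_num⟩
  have hm : (X ^ 3 + X ^ 2 - 2 * X - 1 : ℤ[X]).Monic := by monicity!
  have hirr := irreducible_map_rat_of_irreducible_map_zmod hm 2 (by
    convert irreducible_cubic_zmod_two using 1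
    have h2 : (2 : (ZMod 2)[X]) = 0 := CharTwo.two_eq_zero
    simp only [Polynomial.map_sub, Polynomial.map_add, Polynomial.map_mul, Polynomial.map_pow,
      map_X, Polynomial.map_one, Polynomial.map_ofNat]
    linear_combination (-X - 1) * h2)
  simp only [Polynomial.map_sub, Polynomial.map_add, Polynomial.map_mul, Polynomial.map_pow,
    map_X, Polynomial.map_one, Polynomial.map_ofNat] at hirr
  refine (minpoly.eq_of_irreducible_of_monic hirr ?_ (by monicity!)).symm
  simpa [map_ofNat] using two_cos_two_pi_div_seven_cubic

theorem finrank_adjoin_cos_two_pi_div_seven :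
    Module.finrank ℚ (IntermediateField.adjoin ℚ ({cos (2 * π / 7)} : Set ℝ)) = 3 := by
  have hadj : IntermediateField.adjoin ℚ ({cos (2 * π / 7)} : Set ℝ) =
      IntermediateField.adjoin ℚ ({2 * cos (2 * π / 7)} : Set ℝ) := by
    apply le_antisymm <;> rw [IntermediateField.adjoin_simple_le_iff]
    · have h := mul_mem (inv_mem (ofNat_mem _ 2))
        (IntermediateField.mem_adjoin_simple_self ℚ (2 * cos (2 * π / 7)))
      rwa [inv_mul_cancel_left₀ two_ne_zero] at h
    · exact mul_mem (ofNat_mem _ 2) (IntermediateField.mem_adjoin_simple_self ℚ _)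
  have hd : (X ^ 3 + X ^ 2 - 2 * X - 1 : ℚ[X]).natDegree = 3 := by compute_degree!
  have hint : IsIntegral ℚ (2 * cos (2 * π / 7)) := by
    by_contra h
    rw [← minpoly_two_cos_two_pi_div_seven, minpoly.eq_zero h] at hd
    simp at hd
  rw [hadj, IntermediateField.adjoin.finrank hint, minpoly_two_cos_two_pi_div_seven, hd]

theorem irreducible_anomalous_factor :
    Irreducible (X ^ 4 - 5 * X ^ 3 - 29 * X ^ 2 + 47 * X + 42 : ℚ[X]) := by
  have : Fact (Nat.Prime 5) := ⟨by norm_num⟩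
  have hm : (X ^ 4 - 5 * X ^ 3 - 29 * X ^ 2 + 47 * X + 42 : ℤ[X]).Monic := by monicity!
  have hirr := irreducible_map_rat_of_irreducible_map_zmod hm 5 (by
    convert irreducible_quartic_zmod_five using 1
    have h5 : (5 : (ZMod 5)[X]) = 0 := by
      exact_mod_cast CharP.cast_eq_zero (ZMod 5)[X] 5
    simp only [Polynomial.map_sub, Polynomial.map_add, Polynomial.map_mul, Polynomial.map_pow,
      map_X, Polynomial.map_ofNat]
    linear_combination (-X ^ 3 - 6 * X ^ 2 + 9 * X + 8) * h5)
  simpa only [Polynomial.map_sub, Polynomial.map_add, Polynomial.map_mul, Polynomial.map_pow,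
    map_X, Polynomial.map_ofNat] using hirr

/-- **The anomalous factor stays irreducible over `K = ℚ(cos(2π/7))`.**
Let `K` be the subfield of `ℝ` generated over `ℚ` by `cos(2π/7)`.  Then the
image of `f_anom = X⁴ - 5X³ - 29X² + 47X + 42` in `K[X]` under the inclusion
`ℚ → K` remains irreducible. -/
theorem anomalous_factor_irreducible_over_K
    (K : IntermediateField ℚ ℝ)
    (hK : K = IntermediateField.adjoin ℚ ({Real.cos (2 * Real.pi / 7)} : Set ℝ)) :
    Irreducible (Polynomial.map (algebraMap ℚ K)
      (X ^ 4 - 5 * X ^ 3 - 29 * X ^ 2 + 47 * X + 42 : ℚ[X])) := by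
  subst hK
  have hfin := finrank_adjoin_cos_two_pi_div_seven
  have : FiniteDimensional ℚ (IntermediateField.adjoin ℚ ({Real.cos (2 * Real.pi / 7)} : Set ℝ)) :=
    Module.finite_of_finrank_pos (by omega)
  have hd : (X ^ 4 - 5 * X ^ 3 - 29 * X ^ 2 + 47 * X + 42 : ℚ[X]).natDegree = 4 := by
    compute_degree!
  apply irreducible_map_of_coprime_finrank irreducible_anomalous_factor
  rw [hd, hfin]
  norm_num
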